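/- Let p, q ≥ 1, let U ⊆ ℂ^d be open and connected, and let A : U → Matrix (Fin p) (Fin q) ℂ and C : U → Matrix (Fin q) (Fin q) ℂ be holomorphic (ℂ-differentiable) maps satisfying, for all u ∈ U and v ∈ ℂ^d: (i) fderiv ℂ C u v = (A(u))ᵀ * (fderiv ℂ A u v), and (ii) C(u) + C(u)ᵀ = (A(u))ᵀ * A(u). If the derivative of the combined map u ↦ (A(u), C(u)) is injective at some point of U, then d ≤ q̄(p, q), where q̄(p, q) := p if q = 1; q̄(p, q) := p·q/2 if q > 1 and p is even; and q̄(p, q) := q·(p−1)/2 + 1 if q > 1 and p is odd. (This is the sharp dimension bound for variations of Hodge structure of weight two, with p = h^{1,1} and q = h^{2,0}: in local coordinates such a variation is a solution of the weight-two contact system dY_{2,0} = Y_{1,0}ᵀ dY_{1,0} with Y_{2,0} + Y_{2,0}ᵀ = Y_{1,0}ᵀ Y_{1,0}.) -/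

import Mathlib

open Matrix

attribute [local instance] Matrix.normedAddCommGroup Matrix.normedSpace

open Module Filter Topology

/-- If `T` has maximal rank on the line `T + t • S`, then `S` maps the kernel of `T` into the
range of `T`. -/
theorem LinearMap.apply_mem_range_of_finrank_range_add_smul_le
    {W F : Type*} [AddCommGroup W] [Module ℂ W] [NormedAddCommGroup F] [NormedSpace ℂ F]
    [FiniteDimensional ℂ F] (T S : W →ₗ[ℂ] F)
    (hmax : ∀ t : ℂ, finrank ℂ (T + t • S).range ≤ finrank ℂ T.range)
    {w : W} (hw : T w = 0) : S w ∈ T.range := by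
  by_contra hS
  let b := finBasis ℂ T.range
  choose x hx using fun i => (b i).2
  let v : ℂ → Option (Fin (finrank ℂ T.range)) → F :=
    fun t o => o.elim (S w) fun i => (T + t • S) (x i)
  have hv0 : LinearIndependent ℂ (v 0) := by
    have hb : LinearIndependent ℂ (fun i => (b i : F)) :=
      b.linearIndependent.map' T.range.subtype T.range.ker_subtype
    have hspan : Submodule.span ℂ (Set.range fun i => (b i : F)) ≤ T.range :=
      Submodule.span_le.2 (by rintro _ ⟨i, rfl⟩; exact (b i).2)
    have hv : v 0 = fun o => Option.casesOn' o (S w) fun i => (b i : F) := by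
      funext o
      cases o <;> simp [v, hx]
    rw [hv, linearIndependent_option']
    exact ⟨hb, fun h => hS (hspan h)⟩
  have hcont : Continuous v := by
    refine continuous_pi fun o => ?_
    cases o
    · exact continuous_const
    · simp only [v, Option.elim, LinearMap.add_apply, LinearMap.smul_apply]
      fun_prop
  have hev : ∀ᶠ t in 𝓝[≠] (0 : ℂ), LinearIndependent ℂ (v t) :=
    nhdsWithin_le_nhds
      ((isOpen_setOfPred_linearIndependent.preimage hcont).mem_nhds hv0)
  obtain ⟨t, hvt, ht⟩ := (hev.and self_mem_nhdsWithin).exists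
  have hmem : ∀ o, v t o ∈ (T + t • S).range := by
    rintro (_ | i)
    · refine ⟨t⁻¹ • w, ?_⟩
      simp [v, hw, smul_smul, inv_mul_cancel₀ (show t ≠ 0 from ht)]
    · exact ⟨x i, rfl⟩
  have hli : LinearIndependent ℂ fun o => (⟨v t o, hmem o⟩ : (T + t • S).range) :=
    LinearIndependent.of_comp (T + t • S).range.subtype hvt
  have h := hli.fintype_card_le_finrank
  have := hmax t
  simp at h
  omega

/-- Subspaces of `ℂ^p` orthogonal for the dot product have dimensions adding up to at most `p`. -/
theorem finrank_add_finrank_le_of_dotProduct_eq_zero {p : ℕ} (R I : Submodule ℂ (Fin p → ℂ))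
    (h : ∀ x ∈ I, ∀ y ∈ R, x ⬝ᵥ y = 0) : finrank ℂ R + finrank ℂ I ≤ p := by
  have hle : I.map (dotProductEquiv ℂ (Fin p)).toLinearMap ≤ R.dualAnnihilator := by
    rintro _ ⟨x, hx, rfl⟩
    rw [Submodule.mem_dualAnnihilator]
    exact fun y hy => h x hx y hy
  have h1 := Submodule.finrank_mono hle
  have h2 : finrank ℂ (I.map (dotProductEquiv ℂ (Fin p)).toLinearMap) = finrank ℂ I :=
    LinearEquiv.finrank_map_eq _ _
  have h3 := Subspace.finrank_add_finrank_dualAnnihilator_eq R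
  simp at h3
  omega

/-- A space of `p × q` matrices any two of which satisfy `Xᵀ * Y = Yᵀ * X` has dimension at most
`r + (q - 1) * s`, where `r` is the maximal rank of evaluation at a vector `a`, and `s` is the
dimension of the span of the columns of the matrices that kill `a`. -/
theorem exists_finrank_le_of_transpose_mul_comm {p q : ℕ}
    {W : Type*} [AddCommGroup W] [Module ℂ W] [FiniteDimensional ℂ W]
    (L : W →ₗ[ℂ] Matrix (Fin p) (Fin q) ℂ) (hL : Function.Injective L)
    (hsymm : ∀ v w, (L v)ᵀ * L w = (L w)ᵀ * L v) :
    ∃ r s : ℕ, s ≤ r ∧ r + s ≤ p ∧ finrank ℂ W ≤ r + (q - 1) * s := by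
  let ev : (Fin q → ℂ) → W →ₗ[ℂ] (Fin p → ℂ) := fun a =>
    (mulVecBilin ℂ ℂ).flip a ∘ₗ L
  have hev : ∀ a w, ev a w = L w *ᵥ a := fun _ _ => rfl
  obtain ⟨a, ha⟩ : ∃ a, ∀ b, finrank ℂ (ev b).range ≤ finrank ℂ (ev a).range := by
    have hbdd : BddAbove (Set.range fun b => finrank ℂ (ev b).range) :=
      ⟨p, by rintro _ ⟨b, rfl⟩; simpa using (ev b).range.finrank_le⟩
    obtain ⟨a, ha⟩ := Nat.sSup_mem (Set.range_nonempty _) hbdd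
    exact ⟨a, fun b => (le_csSup hbdd ⟨b, rfl⟩).trans_eq ha.symm⟩
  have hker : ∀ y, ev a y = 0 → ∀ b, ev b y ∈ (ev a).range := fun y hy b =>
    (ev a).apply_mem_range_of_finrank_range_add_smul_le (ev b) (fun t => by
      have : ev a + t • ev b = ev (a + t • b) := by
        ext1 w
        simp [hev, mulVec_add, mulVec_smul]
      rw [this]
      exact ha _) hy
  have horth : ∀ y, ev a y = 0 → ∀ b x, ev b y ⬝ᵥ ev a x = 0 := fun y hy b x => by
    have hy' : L y *ᵥ a = 0 := hy
    rw [hev, hev, dotProduct_mulVec, vecMul_mulVec, ← dotProduct_mulVec, hsymm]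
    rw [← mulVec_mulVec, hy', mulVec_zero, dotProduct_zero]
  by_cases ha0 : a = 0
  · refine ⟨0, 0, le_rfl, by simp, ?_⟩
    have hW : ∀ w : W, w = 0 := fun w => by
      refine hL ?_
      rw [map_zero]
      refine Matrix.ext_of_mulVec_single fun i => ?_
      have h0 : finrank ℂ (ev a).range = 0 := by
        have : ev a = 0 := by ext1 w; simp [hev, ha0]
        rw [this, LinearMap.range_zero, finrank_bot]
      have := Submodule.finrank_eq_zero.1 (Nat.le_zero.1 ((ha (Pi.single i 1)).trans_eq h0))
      have := LinearMap.congr_fun (LinearMap.range_eq_bot.1 this) w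
      exact this.trans (zero_mulVec _).symm
    have : Subsingleton W := ⟨fun x y => (hW x).trans (hW y).symm⟩
    simp [finrank_zero_of_subsingleton]
  · obtain ⟨j, hj⟩ := Function.ne_iff.1 ha0
    let Y : Submodule ℂ (Fin p → ℂ) :=
      Submodule.span ℂ {x | ∃ y b, ev a y = 0 ∧ ev b y = x}
    have hY : Y ≤ (ev a).range :=
      Submodule.span_le.2 (by rintro _ ⟨y, b, hy, rfl⟩; exact hker y hy b)
    have hYorth : ∀ x ∈ Y, ∀ y ∈ (ev a).range, x ⬝ᵥ y = 0 := by
      rintro x hx _ ⟨z, rfl⟩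
      induction hx using Submodule.span_induction with
      | mem x h => obtain ⟨y, b, hy, rfl⟩ := h; exact horth y hy b z
      | zero => simp
      | add x y _ _ hx hy => rw [add_dotProduct, hx, hy, add_zero]
      | smul c x _ hx => rw [smul_dotProduct, hx, smul_zero]
    let Φ : (ev a).ker →ₗ[ℂ] ({i : Fin q // i ≠ j} → Y) :=
      LinearMap.pi fun i => ((ev (Pi.single i.1 1)).domRestrict (ev a).ker).codRestrict Y
        fun y => Submodule.subset_span ⟨y.1, _, y.2, rfl⟩
    have hΦ : Function.Injective Φ := by
      refine (injective_iff_map_eq_zero Φ).2 fun y hy => Subtype.ext (hL ?_)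
      have hcol : ∀ i, i ≠ j → ∀ k, L y.1 k i = 0 := fun i hi k => by
        have := congrFun (congrArg Subtype.val (congrFun hy ⟨i, hi⟩)) k
        simpa [Φ, hev] using this
      have hyk : ∀ k, L y.1 k j = 0 := fun k => by
        have : (L y.1 *ᵥ a) k = 0 := congrFun y.2 k
        rw [mulVec, dotProduct, Finset.sum_eq_single j (fun i _ hi => by simp [hcol i hi k])
          (by simp)] at this
        exact (mul_eq_zero.1 this).resolve_right hj
      ext k i
      by_cases hi : i = j
      · simp [hi, hyk]
      · simp [hcol i hi]
    have hcard : finrank ℂ (ev a).ker ≤ (q - 1) * finrank ℂ Y := by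
      have := LinearMap.finrank_le_finrank_of_injective hΦ
      simpa [finrank_pi_fintype] using this
    refine ⟨finrank ℂ (ev a).range, finrank ℂ Y, Submodule.finrank_mono hY,
      finrank_add_finrank_le_of_dotProduct_eq_zero _ _ hYorth, ?_⟩
    rw [← (ev a).finrank_range_add_finrank_ker]
    omega

/-- An upper bound of `r + (q - 1) * s` over `s ≤ r` and `r + s ≤ p`. -/
theorem add_mul_le_weight_two_bound {p q r s : ℕ} (hq : 1 ≤ q) (hsr : s ≤ r) (hrs : r + s ≤ p) :
    r + (q - 1) * s ≤ if q = 1 then p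
        else if Even p then p * q / 2
        else q * (p - 1) / 2 + 1 := by
  obtain ⟨m, rfl⟩ := Nat.exists_eq_add_of_le' hq
  split_ifs with h1 h2
  · simp_all
    omega
  · rw [Nat.le_div_iff_mul_le two_pos]
    have : 1 ≤ m := by omega
    simp only [Nat.add_sub_cancel]
    nlinarith
  · obtain ⟨k, rfl⟩ := Nat.not_even_iff_odd.1 h2
    have : 1 ≤ m := by omega
    have hs : s ≤ k := by omega
    rw [show (m + 1) * (2 * k + 1 - 1) = 2 * ((m + 1) * k) by simp; ring,
      Nat.mul_div_cancel_left _ two_pos]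
    simp only [Nat.add_sub_cancel]
    obtain ⟨n, rfl⟩ := Nat.exists_eq_add_of_le hs
    obtain ⟨l, rfl⟩ := Nat.exists_eq_add_of_le this
    nlinarith [Nat.zero_le (l * n)]

/-- A holomorphic function on an open subset of a finite-dimensional space is continuously
differentiable. -/
theorem DifferentiableOn.continuousAt_fderiv_complex {E : Type*} [NormedAddCommGroup E]
    [NormedSpace ℂ E] [FiniteDimensional ℂ E] {f : E → ℂ} {U : Set E} (hU : IsOpen U)
    (hf : DifferentiableOn ℂ f U) {x : E} (hx : x ∈ U) : ContinuousAt (fderiv ℂ f) x := by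
  refine continuousAt_clm_apply.2 fun v => ?_
  obtain ⟨ε, hε, hball⟩ := Metric.isOpen_iff.1 hU x hx
  set r : ℝ := ε / 2 / (‖v‖ + 1)
  have hr : 0 < r := by positivity
  have hmem : ∀ u ∈ Metric.ball x (ε / 2), ∀ z ∈ Metric.ball (0 : ℂ) r, u + z • v ∈ U := by
    intro u hu z hz
    refine hball ?_
    have h1 : ‖z • v‖ < ε / 2 := by
      rw [norm_smul]
      have hz' : ‖z‖ < r := by simpa using hz
      calc ‖z‖ * ‖v‖ ≤ ‖z‖ * (‖v‖ + 1) := by gcongr; simp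
        _ < r * (‖v‖ + 1) := by gcongr
        _ = ε / 2 := by simp only [r]; field_simp
    have h2 : ‖u - x‖ < ε / 2 := by simpa [dist_eq_norm] using hu
    rw [Metric.mem_ball, dist_eq_norm, add_sub_right_comm]
    linarith [norm_add_le (u - x) (z • v)]
  have hderiv : ∀ u ∈ Metric.ball x (ε / 2), ∀ z ∈ Metric.ball (0 : ℂ) r,
      HasDerivAt (fun z : ℂ => f (u + z • v)) (fderiv ℂ f (u + z • v) v) z := by
    intro u hu z hz
    have h1 := (hf.differentiableAt (hU.mem_nhds (hmem u hu z hz))).hasFDerivAt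
    have h2 : HasDerivAt (fun z : ℂ => u + z • v) v z := by
      simpa using ((hasDerivAt_id z).smul_const v).const_add u
    exact h1.comp_hasDerivAt z h2
  have hx' : x ∈ Metric.ball x (ε / 2) := Metric.mem_ball_self (by positivity)
  have h0 : (0 : ℂ) ∈ Metric.ball (0 : ℂ) r := Metric.mem_ball_self hr
  have hnear : ∀ᶠ u in 𝓝 x, u ∈ Metric.ball x (ε / 2) := Metric.ball_mem_nhds _ (by positivity)
  have hlim : TendstoLocallyUniformlyOn (fun (u : E) (z : ℂ) => f (u + z • v))
      (fun z => f (x + z • v)) (𝓝 x) (Metric.ball 0 r) := by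
    refine tendstoLocallyUniformlyOn_iff_forall_tendsto.2 fun z hz => ?_
    have hc := (hf.differentiableAt (hU.mem_nhds (hmem x hx' z hz))).continuousAt
    have hle : 𝓝 x ×ˢ 𝓝[Metric.ball 0 r] z ≤ 𝓝 (x, z) := by
      rw [nhds_prod_eq]
      exact Filter.prod_mono le_rfl nhdsWithin_le_nhds
    have t1 : Tendsto (fun y : E × ℂ => x + y.2 • v) (𝓝 (x, z)) (𝓝 (x + z • v)) :=
      Continuous.tendsto (f := fun y : E × ℂ => x + y.2 • v) (by fun_prop) (x, z)
    have t2 : Tendsto (fun y : E × ℂ => y.1 + y.2 • v) (𝓝 (x, z)) (𝓝 (x + z • v)) :=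
      Continuous.tendsto (f := fun y : E × ℂ => y.1 + y.2 • v) (by fun_prop) (x, z)
    exact (((hc.tendsto.comp t1).prodMk_nhds (hc.tendsto.comp t2)).mono_left hle).mono_right
      (nhds_le_uniformity _)
  have hlim' := (hlim.deriv (hnear.mono fun u hu z hz =>
    (hderiv u hu z hz).differentiableAt.differentiableWithinAt) Metric.isOpen_ball).tendsto_at h0
  have hval : ∀ u ∈ Metric.ball x (ε / 2),
      _root_.deriv (fun z : ℂ => f (u + z • v)) 0 = fderiv ℂ f u v := fun u hu => by
    simpa using (hderiv u hu 0 h0).deriv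
  rw [hval x hx'] at hlim'
  exact hlim'.congr' (hnear.mono hval)

/-- The product rule at a zero of the scalar factor needs only continuity of the other factor. -/
theorem HasFDerivAt.smul_of_continuousAt {E F : Type*} [NormedAddCommGroup E] [NormedSpace ℂ E]
    [NormedAddCommGroup F] [NormedSpace ℂ F] {f : E → ℂ} {f' : E →L[ℂ] ℂ} {g : E → F} {x : E}
    (hf : HasFDerivAt f f' x) (hfx : f x = 0) (hg : ContinuousAt g x) :
    HasFDerivAt (fun y => f y • g y) (f'.smulRight (g x)) x := by
  have h1 : HasFDerivAt (fun y => f y • g x) (f'.smulRight (g x)) x := hf.smul_const (g x)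
  have h2 : HasFDerivAt (fun y => f y • (g y - g x)) (0 : E →L[ℂ] F) x := by
    refine .of_isLittleO ?_
    have hO : f =O[𝓝 x] fun y => y - x := by simpa [hfx] using hf.isBigO_sub
    have ho : (fun y => g y - g x) =o[𝓝 x] fun _ => (1 : ℝ) :=
      (Asymptotics.isLittleO_one_iff ℝ).2 (by simpa using hg.tendsto.sub_const (g x))
    have := hO.norm_right.smul_isLittleO ho
    simpa [hfx] using this
  have h := h1.add h2
  rw [add_zero] at h
  exact h.congr_of_eventuallyEq (.of_forall fun y => by simp [smul_sub])

/-- The integrability condition of the system `dC = Aᵀ dA`. -/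
theorem transpose_fderiv_mul_fderiv_comm {E : Type*} [NormedAddCommGroup E] [NormedSpace ℂ E]
    [FiniteDimensional ℂ E] {p q : ℕ} {U : Set E} (hU : IsOpen U)
    {A : E → Matrix (Fin p) (Fin q) ℂ} {C : E → Matrix (Fin q) (Fin q) ℂ}
    (hA : DifferentiableOn ℂ A U) (hC : DifferentiableOn ℂ C U)
    (h : ∀ u ∈ U, ∀ v, fderiv ℂ C u v = (A u)ᵀ * fderiv ℂ A u v)
    {x : E} (hx : x ∈ U) (v w : E) :
    (fderiv ℂ A x v)ᵀ * fderiv ℂ A x w = (fderiv ℂ A x w)ᵀ * fderiv ℂ A x v := by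
  have hAe : ∀ u ∈ U, ∀ k i, HasFDerivAt (fun y => A y k i) (fderiv ℂ (fun y => A y k i) u) u ∧
      ∀ v, fderiv ℂ (fun y => A y k i) u v = fderiv ℂ A u v k i := fun u hu k i => by
    have h0 := (hA.differentiableAt (hU.mem_nhds hu)).hasFDerivAt
    have h1 := hasFDerivAt_pi'.1 (hasFDerivAt_pi'.1 h0 k) i
    exact ⟨h1.differentiableAt.hasFDerivAt, fun v => by rw [h1.fderiv]; rfl⟩
  have hCe : ∀ u ∈ U, ∀ i j, HasFDerivAt (fun y => C y i j)
      (∑ k, A u k i • fderiv ℂ (fun y => A y k j) u) u := fun u hu i j => by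
    have h0 := (hC.differentiableAt (hU.mem_nhds hu)).hasFDerivAt
    have h1 := hasFDerivAt_pi'.1 (hasFDerivAt_pi'.1 h0 i) j
    refine h1.congr_fderiv (ContinuousLinearMap.ext fun v => ?_)
    change fderiv ℂ C u v i j = _
    simp [h u hu v, mul_apply, (hAe u hu _ _).2]
  ext i j
  let G : E → ℂ := fun y => C y i j - ∑ k, A x k i * A y k j
  let G' : E → E →L[ℂ] ℂ := fun y => ∑ k, (A y k i - A x k i) • fderiv ℂ (fun y => A y k j) y
  have hG : ∀ᶠ y in 𝓝 x, HasFDerivAt G (G' y) y := by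
    filter_upwards [hU.mem_nhds hx] with y hy
    have := (hCe y hy i j).sub (HasFDerivAt.fun_sum (u := Finset.univ)
      fun k _ => (hAe y hy k j).1.const_mul (A x k i))
    refine this.congr_fderiv ?_
    simp only [G', ← Finset.sum_sub_distrib]
    exact Finset.sum_congr rfl fun k _ => (sub_smul _ _ _).symm
  have hG' : HasFDerivAt G' (∑ k, (fderiv ℂ (fun y => A y k i) x).smulRight
      (fderiv ℂ (fun y => A y k j) x)) x :=
    HasFDerivAt.fun_sum fun k _ =>
      HasFDerivAt.smul_of_continuousAt ((hAe x hx k i).1.sub_const _) (sub_self _)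
        (DifferentiableOn.continuousAt_fderiv_complex hU
          (fun u hu => (hAe u hu k j).1.differentiableAt.differentiableWithinAt) hx)
  have := second_derivative_symmetric_of_eventually hG hG' v w
  simpa [mul_apply, (hAe x hx _ _).2] using this

/-- Sharp dimension bound for variations of Hodge structure of weight two
(`p = h^{1,1}`, `q = h^{2,0}`): if holomorphic maps `A : U → Mat_{p×q}(ℂ)` and
`C : U → Mat_{q×q}(ℂ)` on a connected open set `U ⊆ ℂ^d` satisfy
`dC = Aᵀ dA` and `C + Cᵀ = Aᵀ A`, and the derivative of `u ↦ (A u, C u)` is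
injective at some point, then `d ≤ q̄(p,q)`, where `q̄(p,q) = p` if `q = 1`,
`q̄(p,q) = pq/2` if `q > 1` and `p` even, and `q̄(p,q) = q(p−1)/2 + 1` if
`q > 1` and `p` odd. -/
theorem stmt_19 (p q d : ℕ) (hp : 1 ≤ p) (hq : 1 ≤ q)
    (U : Set (Fin d → ℂ)) (hU : IsOpen U) (hUconn : IsConnected U)
    (A : (Fin d → ℂ) → Matrix (Fin p) (Fin q) ℂ)
    (C : (Fin d → ℂ) → Matrix (Fin q) (Fin q) ℂ)
    (hA : DifferentiableOn ℂ A U) (hC : DifferentiableOn ℂ C U)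
    (h1 : ∀ u ∈ U, ∀ v : Fin d → ℂ, fderiv ℂ C u v = (A u)ᵀ * fderiv ℂ A u v)
    (h2 : ∀ u ∈ U, C u + (C u)ᵀ = (A u)ᵀ * A u)
    (u₀ : Fin d → ℂ) (hu₀ : u₀ ∈ U)
    (hinj : Function.Injective (fderiv ℂ (fun u => (A u, C u)) u₀)) :
    d ≤ if q = 1 then p
        else if Even p then p * q / 2
        else q * (p - 1) / 2 + 1 := by
  have hinjA : Function.Injective (fderiv ℂ A u₀) := by
    refine (injective_iff_map_eq_zero _).2 fun v hv => hinj ?_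
    have hAC : fderiv ℂ (fun u => (A u, C u)) u₀ = (fderiv ℂ A u₀).prod (fderiv ℂ C u₀) :=
      ((hA.differentiableAt (hU.mem_nhds hu₀)).hasFDerivAt.prodMk
        (hC.differentiableAt (hU.mem_nhds hu₀)).hasFDerivAt).fderiv
    have hCv : fderiv ℂ C u₀ v = 0 := by rw [h1 u₀ hu₀, hv, Matrix.mul_zero]
    rw [map_zero, hAC, ContinuousLinearMap.prod_apply, hv, hCv, Prod.mk_zero_zero]
  obtain ⟨r, s, hsr, hrs, hd⟩ := exists_finrank_le_of_transpose_mul_comm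
    (fderiv ℂ A u₀).toLinearMap hinjA (transpose_fderiv_mul_fderiv_comm hU hA hC h1 hu₀)
  rw [finrank_fin_fun] at hd
  exact hd.trans (add_mul_le_weight_two_bound hq hsr hrs)
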